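/- Let 𝔾 be a finite connected transitive graph. For every real s ≥ 1 and every p ∈ (0,1), Var_p[Z_{≥s}] ≤ (1 + pΩs)·V·χ_{<s}(p) ≤ 4s(1 + pΩs)·V·M(p, s^{-1}). -/

import Mathlib

noncomputable section
open Classical

namespace Percolation

variable {V : Type*} [Fintype V] [DecidableEq V]

/-- A percolation configuration: an assignment of occupied (`true`) or
vacant (`false`) to each bond of the graph. -/
def Config (G : SimpleGraph V) : Type _ := G.edgeSet → Bool

noncomputable instance (G : SimpleGraph V) : Fintype G.edgeSet :=
  Fintype.ofFinite _

noncomputable instance (G : SimpleGraph V) : Fintype (Config G) :=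
  inferInstanceAs (Fintype (G.edgeSet → Bool))

/-- The probability weight of a configuration under the product Bernoulli
measure with parameter `p`. -/
def weight (G : SimpleGraph V) (p : ℝ) (ω : Config G) : ℝ :=
  ∏ e : G.edgeSet, if ω e then p else 1 - p

/-- The probability of an event under the percolation measure `ℙ_p`. -/
def prob (G : SimpleGraph V) (p : ℝ) (A : Config G → Prop) : ℝ :=
  ∑ ω : Config G, if A ω then weight G p ω else 0

/-- The expectation of a random variable under the percolation measure `ℙ_p`. -/
def expect (G : SimpleGraph V) (p : ℝ) (f : Config G → ℝ) : ℝ :=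
  ∑ ω : Config G, weight G p ω * f ω

/-- The subgraph consisting of the occupied bonds of a configuration. -/
def occupied (G : SimpleGraph V) (ω : Config G) : SimpleGraph V :=
  SimpleGraph.fromEdgeSet {e | ∃ h : e ∈ G.edgeSet, ω ⟨e, h⟩ = true}

/-- The cluster `C(x)` of the vertex `x`: all vertices joined to `x` by a path
of occupied bonds (including `x` itself). -/
def cluster (G : SimpleGraph V) (ω : Config G) (x : V) : Finset V :=
  Finset.univ.filter fun y => (occupied G ω).Reachable x y

/-- The susceptibility `χ(p)`: the expected size of the cluster of `x₀`. -/
def chi (G : SimpleGraph V) (x₀ : V) (p : ℝ) : ℝ :=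
  expect G p fun ω => ((cluster G ω x₀).card : ℝ)

/-- The two-point function `τ_p(x,y) = ℙ_p(x ↔ y)`. -/
def tau (G : SimpleGraph V) (p : ℝ) (x y : V) : ℝ :=
  prob G p fun ω => (occupied G ω).Reachable x y

/-- The triangle diagram `∇_p(x,y)`. -/
def triangle (G : SimpleGraph V) (p : ℝ) (x y : V) : ℝ :=
  ∑ u : V, ∑ v : V, tau G p x u * tau G p u v * tau G p v y

/-- The Kronecker delta `δ_{x,y}`. -/
def kron (x y : V) : ℝ := if x = y then 1 else 0

/-- `∇̄_p`: the maximum of the triangle diagram over bonds `{x,y} ∈ 𝔹`. -/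
def nablaBar (G : SimpleGraph V) (p : ℝ) : ℝ :=
  sSup {t : ℝ | ∃ x y : V, G.Adj x y ∧ t = triangle G p x y}

/-- A graph is (vertex-)transitive if any vertex can be mapped to any other
by a graph automorphism. -/
def IsTransitive (G : SimpleGraph V) : Prop :=
  ∀ x y : V, ∃ φ : G ≃g G, φ x = y

/-- The size `|C_max|` of the largest cluster. -/
def maxCluster (G : SimpleGraph V) (ω : Config G) : ℕ :=
  Finset.univ.sup fun x => (cluster G ω x).card

/-- The cluster size distribution `P_{≥k}(p) = ℙ_p(|C(x₀)| ≥ k)`. -/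
def Pgeq (G : SimpleGraph V) (x₀ : V) (p : ℝ) (k : ℝ) : ℝ :=
  prob G p fun ω => k ≤ ((cluster G ω x₀).card : ℝ)

/-- The magnetization `M(p,γ)`. -/
def magnetization (G : SimpleGraph V) (x₀ : V) (p γ : ℝ) : ℝ :=
  ∑ k ∈ Finset.Icc 1 (Fintype.card V),
    (1 - (1 - γ) ^ k) * prob G p fun ω => (cluster G ω x₀).card = k

/-- `Z_{≥s}`: the number of vertices lying in clusters of size at least `s`. -/
def Zgeq (G : SimpleGraph V) (s : ℝ) (ω : Config G) : ℝ :=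
  ∑ x : V, if s ≤ ((cluster G ω x).card : ℝ) then (1 : ℝ) else 0

/-- The variance of a random variable under `ℙ_p`. -/
def variance (G : SimpleGraph V) (p : ℝ) (f : Config G → ℝ) : ℝ :=
  expect G p (fun ω => f ω ^ 2) - (expect G p f) ^ 2

/-- The restricted susceptibility `χ_{≥s}(p) = 𝔼_p[|C(x₀)| I[|C(x₀)| ≥ s]]`. -/
def chiGeq (G : SimpleGraph V) (x₀ : V) (p : ℝ) (s : ℝ) : ℝ :=
  expect G p fun ω =>
    if s ≤ ((cluster G ω x₀).card : ℝ) then ((cluster G ω x₀).card : ℝ) else 0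

/-- The restricted susceptibility `χ_{<s}(p) = 𝔼_p[|C(x₀)| I[|C(x₀)| < s]]`. -/
def chiLt (G : SimpleGraph V) (x₀ : V) (p : ℝ) (s : ℝ) : ℝ :=
  expect G p fun ω =>
    if ((cluster G ω x₀).card : ℝ) < s then ((cluster G ω x₀).card : ℝ) else 0

end Percolation

namespace Percolation

section aux

variable {V : Type*} [Fintype V] [DecidableEq V]

theorem weight_nonneg (G : SimpleGraph V) {p : ℝ} (hp0 : 0 < p) (hp1 : p < 1) (ω : Config G) :
    0 ≤ weight G p ω := by
  unfold weight
  refine Finset.prod_nonneg fun e _ => ?_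
  split_ifs <;> linarith

theorem sum_prod_bool (G : SimpleGraph V) (h : G.edgeSet → Bool → ℝ) :
    ∑ ω : Config G, ∏ e : G.edgeSet, h e (ω e) = ∏ e : G.edgeSet, ∑ b : Bool, h e b :=
  (Fintype.prod_sum h).symm

theorem sum_weight (G : SimpleGraph V) (p : ℝ) : ∑ ω : Config G, weight G p ω = 1 := by
  have := sum_prod_bool G (fun _ b => if b then p else 1 - p)
  simp only [weight]
  rw [this]
  simp

theorem expect_const (G : SimpleGraph V) (p c : ℝ) : expect G p (fun _ => c) = c := by
  unfold expect
  rw [← Finset.sum_mul, sum_weight, one_mul]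

theorem expect_mono (G : SimpleGraph V) {p : ℝ} (hp0 : 0 < p) (hp1 : p < 1)
    {f g : Config G → ℝ} (h : ∀ ω, f ω ≤ g ω) : expect G p f ≤ expect G p g :=
  Finset.sum_le_sum fun ω _ => mul_le_mul_of_nonneg_left (h ω) (weight_nonneg G hp0 hp1 ω)

theorem expect_add (G : SimpleGraph V) (p : ℝ) (f g : Config G → ℝ) :
    expect G p (fun ω => f ω + g ω) = expect G p f + expect G p g := by
  simp [expect, mul_add, Finset.sum_add_distrib]

theorem expect_sub (G : SimpleGraph V) (p : ℝ) (f g : Config G → ℝ) :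
    expect G p (fun ω => f ω - g ω) = expect G p f - expect G p g := by
  simp [expect, mul_sub, Finset.sum_sub_distrib]

theorem expect_mul_const (G : SimpleGraph V) (p c : ℝ) (f : Config G → ℝ) :
    expect G p (fun ω => f ω * c) = expect G p f * c := by
  simp [expect, Finset.sum_mul, mul_assoc]

theorem expect_sum (G : SimpleGraph V) (p : ℝ) {ι : Type*} (t : Finset ι) (f : ι → Config G → ℝ) :
    expect G p (fun ω => ∑ i ∈ t, f i ω) = ∑ i ∈ t, expect G p (f i) := by
  simp only [expect, Finset.mul_sum]
  rw [Finset.sum_comm]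

/-- swapping two configurations on a set of bonds -/
def mix (G : SimpleGraph V) (S : Set G.edgeSet) (ω ω' : Config G) : Config G :=
  fun e => if e ∈ S then ω e else ω' e

theorem expect_indep (G : SimpleGraph V) (p : ℝ) (S : Set G.edgeSet) (f g : Config G → ℝ)
    (hf : ∀ ω ω' : Config G, (∀ e ∈ S, ω e = ω' e) → f ω = f ω')
    (hg : ∀ ω ω' : Config G, (∀ e, e ∉ S → ω e = ω' e) → g ω = g ω') :
    expect G p (fun ω => f ω * g ω) = expect G p f * expect G p g := by
  have hinv : Function.Involutive
      (fun q : Config G × Config G => (mix G S q.1 q.2, mix G S q.2 q.1)) := by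
    rintro ⟨ω, ω'⟩
    refine Prod.ext ?_ ?_ <;> funext e <;> by_cases h : e ∈ S <;> simp [mix, h]
  have h1 : expect G p f * expect G p g = ∑ q : Config G × Config G,
      (weight G p q.1 * f q.1) * (weight G p q.2 * g q.2) := by
    rw [Fintype.sum_prod_type]
    unfold expect
    rw [Finset.sum_mul_sum]
  have h2 : expect G p (fun ω => f ω * g ω) = ∑ q : Config G × Config G,
      (weight G p q.1 * (f q.1 * g q.1)) * weight G p q.2 := by
    rw [Fintype.sum_prod_type]
    unfold expect
    rw [← mul_one (∑ ω, _), ← sum_weight G p, Finset.sum_mul_sum]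
  rw [h1, h2]
  refine (Fintype.sum_equiv hinv.toPerm _ _ ?_).symm
  rintro ⟨ω, ω'⟩
  have ha : f (mix G S ω ω') = f ω := hf _ _ fun e he => by simp [mix, he]
  have hb : g (mix G S ω ω') = g ω' := hg _ _ fun e he => by simp [mix, he]
  have hw : weight G p (mix G S ω ω') * weight G p (mix G S ω' ω)
      = weight G p ω * weight G p ω' := by
    simp only [weight]
    rw [← Finset.prod_mul_distrib, ← Finset.prod_mul_distrib]
    refine Finset.prod_congr rfl fun e _ => ?_
    by_cases h : e ∈ S
    · simp [mix, h]
    · simp only [mix, h, if_false]; ring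
  simp only [Function.Involutive.coe_toPerm, ha, hb]
  linear_combination (-(f ω * g ω')) * hw

theorem expect_edge (G : SimpleGraph V) (p : ℝ) (e₀ : G.edgeSet) :
    expect G p (fun ω => if ω e₀ = true then (1 : ℝ) else 0) = p := by
  have := sum_prod_bool G (fun e b => if e = e₀ then (if b then p else 0) else
    (if b then p else 1 - p))
  have h2 : ∀ ω : Config G, weight G p ω * (if ω e₀ = true then (1 : ℝ) else 0) =
      ∏ e : G.edgeSet, (if e = e₀ then (if ω e then p else 0) else
    (if ω e then p else 1 - p)) := by
    intro ω
    unfold weight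
    rw [← Finset.mul_prod_erase _ _ (Finset.mem_univ e₀),
      ← Finset.mul_prod_erase _ _ (Finset.mem_univ e₀)]
    rw [Finset.prod_congr rfl (g := fun e => if ω e then p else 1 - p)
      (s₁ := Finset.univ.erase e₀) (s₂ := Finset.univ.erase e₀)
      (f := fun e => (if e = e₀ then (if ω e then p else 0) else
        (if ω e then p else 1 - p)))
      (fun e he => by rw [if_neg (Finset.ne_of_mem_erase he)])]
    by_cases h : ω e₀ = true <;> simp [h]
  unfold expect
  rw [Finset.sum_congr rfl fun ω _ => h2 ω, this]
  rw [Finset.prod_eq_single e₀]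
  · simp
  · intro b _ hb; simp [hb]
  · simp

theorem occ_adj (G : SimpleGraph V) (ω : Config G) (x y : V) :
    (occupied G ω).Adj x y ↔ ∃ h : G.Adj x y, ω ⟨s(x, y), h⟩ = true := by
  unfold occupied
  rw [SimpleGraph.fromEdgeSet_adj]
  constructor
  · rintro ⟨⟨h, h'⟩, _⟩
    exact ⟨h, h'⟩
  · rintro ⟨h, h'⟩
    exact ⟨⟨h, h'⟩, h.ne⟩

theorem mem_cluster (G : SimpleGraph V) (ω : Config G) (x y : V) :
    y ∈ cluster G ω x ↔ (occupied G ω).Reachable x y := by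
  simp [cluster]

theorem reach_ind {H : SimpleGraph V} {x : V} (P : V → Prop) (h0 : P x)
    (hstep : ∀ y z, H.Reachable x y → P y → H.Adj y z → P z) {y : V} (h : H.Reachable x y) :
    P y := by
  rw [SimpleGraph.reachable_iff_reflTransGen] at h
  induction h with
  | refl => exact h0
  | tail h1 h2 ih =>
    exact hstep _ _ ((SimpleGraph.reachable_iff_reflTransGen _ _).2 h1) ih h2

/-- bonds touching `A` -/
def touch (G : SimpleGraph V) (A : Finset V) : Set G.edgeSet := {e | ∃ a ∈ A, a ∈ e.1}

/-- close all bonds touching `A` -/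
def restr (G : SimpleGraph V) (A : Finset V) (ω : Config G) : Config G :=
  fun e => if e ∈ touch G A then false else ω e

theorem mem_touch (G : SimpleGraph V) (A : Finset V) (x y : V) (h : G.Adj x y) :
    (⟨s(x, y), h⟩ : G.edgeSet) ∈ touch G A ↔ x ∈ A ∨ y ∈ A := by
  constructor
  · rintro ⟨a, ha, hm⟩
    rcases Sym2.mem_iff.1 hm with rfl | rfl
    · exact Or.inl ha
    · exact Or.inr ha
  · rintro (h | h)
    · exact ⟨x, h, Sym2.mem_iff.2 (Or.inl rfl)⟩
    · exact ⟨y, h, Sym2.mem_iff.2 (Or.inr rfl)⟩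

theorem restr_adj (G : SimpleGraph V) (A : Finset V) (ω : Config G) (x y : V) :
    (occupied G (restr G A ω)).Adj x y ↔ (occupied G ω).Adj x y ∧ x ∉ A ∧ y ∉ A := by
  simp only [occ_adj]
  constructor
  · rintro ⟨h, h'⟩
    by_cases ht : (⟨s(x, y), h⟩ : G.edgeSet) ∈ touch G A
    · simp [restr, ht] at h'
    · rw [mem_touch] at ht
      push Not at ht
      have : (⟨s(x, y), h⟩ : G.edgeSet) ∉ touch G A := by rw [mem_touch]; tauto
      simp only [restr, this, if_false] at h'
      exact ⟨⟨h, h'⟩, ht⟩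
  · rintro ⟨⟨h, h'⟩, ht⟩
    refine ⟨h, ?_⟩
    have : (⟨s(x, y), h⟩ : G.edgeSet) ∉ touch G A := by rw [mem_touch]; tauto
    simpa [restr, this] using h'

theorem restr_le (G : SimpleGraph V) (A : Finset V) (ω : Config G) :
    occupied G (restr G A ω) ≤ occupied G ω :=
  fun _ _ h => ((restr_adj G A ω _ _).1 h).1

theorem cluster_restr (G : SimpleGraph V) (ω : Config G) (x y : V)
    (hy : y ∉ cluster G ω x) :
    cluster G (restr G (cluster G ω x) ω) y = cluster G ω y := by
  ext z
  rw [mem_cluster, mem_cluster]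
  refine ⟨fun h => h.mono (restr_le G _ ω), fun h => ?_⟩
  have key : ∀ w, (occupied G ω).Reachable y w → w ∉ cluster G ω x := by
    intro w hw hm
    apply hy
    rw [mem_cluster] at *
    exact hm.trans hw.symm
  refine reach_ind (fun w => (occupied G (restr G (cluster G ω x) ω)).Reachable y w)
    (SimpleGraph.Reachable.refl _) ?_ h
  intro a b ha ih hab
  refine ih.trans (SimpleGraph.Adj.reachable ?_)
  rw [restr_adj]
  exact ⟨hab, key a ha, key b (ha.trans hab.reachable)⟩

theorem cluster_eq_of_agree (G : SimpleGraph V) (A : Finset V) (x : V) (ω ω' : Config G)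
    (h : ∀ e ∈ touch G A, ω e = ω' e) (hA : cluster G ω x = A) : cluster G ω' x = A := by
  have adj : ∀ a b, (a ∈ A ∨ b ∈ A) → ((occupied G ω).Adj a b ↔ (occupied G ω').Adj a b) := by
    intro a b hab
    simp only [occ_adj]
    refine exists_congr fun hG => ?_
    rw [h _ ((mem_touch G A a b hG).2 hab)]
  have memA : ∀ z, z ∈ A ↔ (occupied G ω).Reachable x z := by
    intro z; rw [← hA, mem_cluster]
  ext z
  rw [mem_cluster]
  constructor
  · intro hz
    refine reach_ind (fun w => w ∈ A) ((memA x).2 (SimpleGraph.Reachable.refl _)) ?_ hz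
    intro a b _ ha hab
    rw [memA]
    exact ((memA a).1 ha).trans ((adj a b (Or.inl ha)).2 hab).reachable
  · intro hz
    refine reach_ind (fun w => (occupied G ω').Reachable x w)
      (SimpleGraph.Reachable.refl _) ?_ ((memA z).1 hz)
    intro a b ha ih hab
    exact ih.trans ((adj a b (Or.inl ((memA a).2 ha))).1 hab).reachable

theorem exists_bond (G : SimpleGraph V) (A : Finset V) (ω : Config G) (y : V) (hy : y ∉ A)
    (hlt : (cluster G (restr G A ω) y).card < (cluster G ω y).card) :
    ∃ a ∈ A, ∃ b, b ∉ A ∧ (occupied G ω).Adj a b ∧ b ∈ cluster G (restr G A ω) y := by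
  by_contra hcon
  push Not at hcon
  refine absurd hlt (not_lt.2 (Finset.card_le_card ?_))
  intro z hz
  rw [mem_cluster] at hz
  refine (reach_ind (fun w => w ∉ A ∧ w ∈ cluster G (restr G A ω) y)
    ⟨hy, (mem_cluster _ _ _ _).2 (SimpleGraph.Reachable.refl _)⟩ ?_ hz).2
  rintro a b _ ⟨haA, ha⟩ hab
  have hb : b ∉ A := fun hb => hcon b hb a haA hab.symm ha
  refine ⟨hb, ?_⟩
  rw [mem_cluster] at ha ⊢
  exact ha.trans ((restr_adj G A ω a b).2 ⟨hab, haA, hb⟩).reachable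

/-- indicator of a small cluster -/
def q (G : SimpleGraph V) (s : ℝ) (ω : Config G) (y : V) : ℝ :=
  if ((cluster G ω y).card : ℝ) < s then 1 else 0

theorem q_nonneg (G : SimpleGraph V) (s : ℝ) (ω : Config G) (y : V) : 0 ≤ q G s ω y := by
  unfold q; split_ifs <;> norm_num

theorem q_le_one (G : SimpleGraph V) (s : ℝ) (ω : Config G) (y : V) : q G s ω y ≤ 1 := by
  unfold q; split_ifs <;> norm_num

theorem cluster_comm (G : SimpleGraph V) (ω : Config G) {x y : V} (h : y ∈ cluster G ω x) :
    cluster G ω x = cluster G ω y := by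
  rw [mem_cluster] at h
  ext z
  rw [mem_cluster, mem_cluster]
  exact ⟨fun k => h.symm.trans k, fun k => h.trans k⟩

/-- number of vertices in small clusters -/
def Zl (G : SimpleGraph V) (s : ℝ) (ω : Config G) : ℝ := ∑ y, q G s ω y

def openI (G : SimpleGraph V) (ω : Config G) (a b : V) : ℝ :=
  if (occupied G ω).Adj a b then 1 else 0

theorem openI_nonneg (G : SimpleGraph V) (ω : Config G) (a b : V) : 0 ≤ openI G ω a b := by
  unfold openI; split_ifs <;> norm_num

theorem sum_q_inter (G : SimpleGraph V) (s : ℝ) (hs : 1 ≤ s) (ω : Config G) (b : V) :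
    ∑ y, (if b ∈ cluster G ω y then q G s ω y else 0) ≤ s := by
  have : ∀ y, (if b ∈ cluster G ω y then q G s ω y else 0)
      = if y ∈ cluster G ω b then q G s ω b else 0 := by
    intro y
    by_cases h : b ∈ cluster G ω y
    · have h2 : y ∈ cluster G ω b := by
        rw [mem_cluster] at *; exact h.symm
      rw [if_pos h, if_pos h2]
      unfold q
      rw [cluster_comm G ω h]
    · have h2 : y ∉ cluster G ω b := by
        rw [mem_cluster] at *; exact fun k => h k.symm
      rw [if_neg h, if_neg h2]
  rw [Finset.sum_congr rfl fun y _ => this y]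
  rw [Finset.sum_ite_mem, Finset.univ_inter, Finset.sum_const, nsmul_eq_mul]
  unfold q
  split_ifs with h
  · linarith
  · linarith

/-- deterministic comparison -/
theorem Zrestr_le (G : SimpleGraph V) (s : ℝ) (hs : 1 ≤ s) (A : Finset V) (ω : Config G) :
    ∑ y ∈ Aᶜ, q G s (restr G A ω) y ≤
      Zl G s ω + ∑ a ∈ A, ∑ b, openI G ω a b * s := by
  have h1 : ∀ y ∈ Aᶜ, q G s (restr G A ω) y ≤ q G s ω y +
      ∑ a ∈ A, ∑ b, openI G ω a b *
        (if b ∈ cluster G (restr G A ω) y then q G s (restr G A ω) y else 0) := by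
    intro y hy
    have hy' : y ∉ A := by simpa using hy
    have hterm : ∀ a b, 0 ≤ openI G ω a b *
        (if b ∈ cluster G (restr G A ω) y then q G s (restr G A ω) y else 0) := by
      intro a b
      refine mul_nonneg (openI_nonneg _ _ _ _) ?_
      split_ifs
      · exact q_nonneg _ _ _ _
      · exact le_rfl
    have hsum : 0 ≤ ∑ a ∈ A, ∑ b, openI G ω a b *
        (if b ∈ cluster G (restr G A ω) y then q G s (restr G A ω) y else 0) :=
      Finset.sum_nonneg fun a _ => Finset.sum_nonneg fun b _ => hterm a b
    by_cases hq : ((cluster G (restr G A ω) y).card : ℝ) < s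
    · by_cases hq2 : ((cluster G ω y).card : ℝ) < s
      · have e1 : q G s (restr G A ω) y = 1 := by simp [q, hq]
        have e2 : q G s ω y = 1 := by simp [q, hq2]
        linarith
      · obtain ⟨a, ha, b, hb, hab, hm⟩ := exists_bond G A ω y hy' (by
          have := lt_of_lt_of_le hq (not_lt.1 hq2)
          exact_mod_cast this)
        have e1 : q G s (restr G A ω) y = 1 := by simp [q, hq]
        have k1 := Finset.single_le_sum
          (f := fun a => ∑ b, openI G ω a b *
            (if b ∈ cluster G (restr G A ω) y then q G s (restr G A ω) y else 0))
          (fun a _ => Finset.sum_nonneg fun b _ => hterm a b) ha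
        have k2 := Finset.single_le_sum
          (f := fun b => openI G ω a b *
            (if b ∈ cluster G (restr G A ω) y then q G s (restr G A ω) y else 0))
          (fun b _ => hterm a b) (Finset.mem_univ b)
        have e3 : openI G ω a b = 1 := by simp [openI, hab]
        simp only [e3, if_pos hm, e1, one_mul] at k2
        simp only [e1] at k1 ⊢
        have := q_nonneg G s ω y
        linarith
    · have e1 : q G s (restr G A ω) y = 0 := by simp [q, hq]
      rw [e1] at hsum ⊢
      have := q_nonneg G s ω y
      linarith
  refine (Finset.sum_le_sum h1).trans ?_
  rw [Finset.sum_add_distrib]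
  refine add_le_add ?_ ?_
  · exact Finset.sum_le_sum_of_subset_of_nonneg (Finset.subset_univ _)
      fun y _ _ => q_nonneg G s ω y
  · rw [Finset.sum_comm]
    refine Finset.sum_le_sum fun a _ => ?_
    rw [Finset.sum_comm]
    refine Finset.sum_le_sum fun b _ => ?_
    rw [← Finset.mul_sum]
    refine mul_le_mul_of_nonneg_left ?_ (openI_nonneg _ _ _ _)
    refine le_trans ?_ (sum_q_inter G s hs (restr G A ω) b)
    refine Finset.sum_le_sum_of_subset_of_nonneg (Finset.subset_univ _) fun y _ _ => ?_
    split_ifs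
    · exact q_nonneg _ _ _ _
    · exact le_rfl

theorem expect_openI (G : SimpleGraph V) [DecidableRel G.Adj] (p : ℝ) (a b : V) :
    expect G p (fun ω => openI G ω a b) = if G.Adj a b then p else 0 := by
  by_cases h : G.Adj a b
  · rw [if_pos h]
    refine Eq.trans ?_ (expect_edge G p ⟨s(a, b), h⟩)
    congr 1
    funext ω
    unfold openI
    congr 1
    rw [occ_adj]
    simp [h]
  · rw [if_neg h]
    have : ∀ ω, openI G ω a b = 0 := by
      intro ω
      unfold openI
      rw [if_neg]
      rw [occ_adj]
      rintro ⟨h', _⟩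
      exact h h'
    simp only [this]
    exact expect_const G p 0

theorem expect_Zrestr (G : SimpleGraph V) [DecidableRel G.Adj] (Ω : ℕ)
    (hreg : G.IsRegularOfDegree Ω) (s : ℝ) (hs : 1 ≤ s) (p : ℝ) (hp0 : 0 < p) (hp1 : p < 1)
    (A : Finset V) :
    expect G p (fun ω => ∑ y ∈ Aᶜ, q G s (restr G A ω) y) ≤
      expect G p (Zl G s) + p * Ω * s * A.card := by
  refine (expect_mono G hp0 hp1 (Zrestr_le G s hs A)).trans ?_
  rw [expect_add]
  refine add_le_add le_rfl (le_of_eq ?_)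
  rw [expect_sum]
  have : ∀ a, expect G p (fun ω => ∑ b, openI G ω a b * s) = p * Ω * s := by
    intro a
    rw [expect_sum]
    simp only [expect_mul_const, expect_openI]
    rw [← Finset.sum_mul]
    congr 1
    rw [← Finset.sum_filter, Finset.sum_const, nsmul_eq_mul, mul_comm]
    congr 2
    rw [← hreg a, ← SimpleGraph.card_neighborFinset_eq_degree]
    congr 1
    ext b
    simp
  rw [Finset.sum_congr rfl fun a _ => this a]
  simp [mul_comm]

/-- indicator that the cluster of `x` is `A` -/
def cI (G : SimpleGraph V) (x : V) (A : Finset V) (ω : Config G) : ℝ :=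
  if cluster G ω x = A then 1 else 0

theorem sum_cI (G : SimpleGraph V) (x : V) (ω : Config G) (f : Finset V → ℝ) :
    ∑ A, cI G x A ω * f A = f (cluster G ω x) := by
  simp [cI]

theorem cI_bound (G : SimpleGraph V) [DecidableRel G.Adj] (Ω : ℕ)
    (hreg : G.IsRegularOfDegree Ω) (s : ℝ) (hs : 1 ≤ s) (p : ℝ) (hp0 : 0 < p) (hp1 : p < 1)
    (x : V) (A : Finset V) :
    expect G p (fun ω => cI G x A ω * Zl G s ω) ≤
      expect G p (cI G x A) * (A.card + (expect G p (Zl G s) + p * Ω * s * A.card)) := by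
  have h1 : ∀ ω, cI G x A ω * Zl G s ω ≤
      cI G x A ω * A.card + cI G x A ω * ∑ y ∈ Aᶜ, q G s (restr G A ω) y := by
    intro ω
    unfold cI
    split_ifs with h
    · rw [one_mul, one_mul, one_mul]
      unfold Zl
      rw [← Finset.sum_add_sum_compl A]
      refine add_le_add ?_ (le_of_eq ?_)
      · refine (Finset.sum_le_sum fun y _ => q_le_one G s ω y).trans ?_
        simp
      · refine Finset.sum_congr rfl fun y hy => ?_
        have hy' : y ∉ cluster G ω x := by rw [h]; simpa using hy
        unfold q
        rw [← h, cluster_restr G ω x y hy']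
    · simp
  refine (expect_mono G hp0 hp1 h1).trans ?_
  rw [expect_add, expect_mul_const, mul_add]
  refine add_le_add le_rfl ?_
  rw [expect_indep G p (touch G A) (cI G x A)]
  · refine mul_le_mul_of_nonneg_left (expect_Zrestr G Ω hreg s hs p hp0 hp1 A) ?_
    rw [← expect_const G p 0]
    refine expect_mono G hp0 hp1 fun ω => ?_
    unfold cI; split_ifs <;> norm_num
  · intro ω ω' h
    unfold cI
    congr 1
    exact propext ⟨cluster_eq_of_agree G A x ω ω' h,
      cluster_eq_of_agree G A x ω' ω fun e he => (h e he).symm⟩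
  · intro ω ω' h
    have : restr G A ω = restr G A ω' := by
      funext e
      unfold restr
      split_ifs with he
      · rfl
      · exact h e he
    rw [this]

theorem qZ_bound (G : SimpleGraph V) [DecidableRel G.Adj] (Ω : ℕ)
    (hreg : G.IsRegularOfDegree Ω) (s : ℝ) (hs : 1 ≤ s) (p : ℝ) (hp0 : 0 < p) (hp1 : p < 1)
    (x : V) :
    expect G p (fun ω => q G s ω x * Zl G s ω) ≤
      (1 + p * Ω * s) * chiLt G x p s +
        expect G p (fun ω => q G s ω x) * expect G p (Zl G s) := by
  let r : Finset V → ℝ := fun A => if (A.card : ℝ) < s then 1 else 0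
  have hr : ∀ A, 0 ≤ r A := by intro A; simp only [r]; split_ifs <;> norm_num
  have e1 : expect G p (fun ω => q G s ω x * Zl G s ω) =
      ∑ A, expect G p (fun ω => cI G x A ω * Zl G s ω) * r A := by
    simp only [← expect_mul_const]
    rw [← expect_sum]
    congr 1
    funext ω
    simp only [mul_assoc]
    rw [sum_cI G x ω (fun A => Zl G s ω * r A), mul_comm]
    rfl
  have e2 : chiLt G x p s = ∑ A, expect G p (cI G x A) * (A.card * r A) := by
    simp only [← expect_mul_const]
    rw [← expect_sum]
    unfold chiLt
    congr 1
    funext ω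
    rw [sum_cI G x ω (fun A => A.card * r A)]
    simp [r]
  have e3 : expect G p (fun ω => q G s ω x) = ∑ A, expect G p (cI G x A) * r A := by
    simp only [← expect_mul_const]
    rw [← expect_sum]
    congr 1
    funext ω
    rw [sum_cI G x ω r]
    rfl
  rw [e1, e2, e3, Finset.mul_sum, Finset.sum_mul, ← Finset.sum_add_distrib]
  refine Finset.sum_le_sum fun A _ => ?_
  refine (mul_le_mul_of_nonneg_right (cI_bound G Ω hreg s hs p hp0 hp1 x A) (hr A)).trans
    (le_of_eq ?_)
  ring

/-- pull back a configuration along an automorphism -/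
def pull (G : SimpleGraph V) (φ : G ≃g G) (ω : Config G) : Config G :=
  fun e => ω (φ.mapEdgeSet e)

theorem card_cluster_iso (G : SimpleGraph V) (φ : G ≃g G) (ω : Config G) (x : V) :
    (cluster G (pull G φ ω) x).card = (cluster G ω (φ x)).card := by
  let ψ : occupied G (pull G φ ω) ≃g occupied G ω :=
    { toEquiv := φ.toEquiv
      map_rel_iff' := by
        intro a b
        refine (occ_adj G ω _ _).trans (Iff.trans ?_ (occ_adj G (pull G φ ω) a b).symm)
        constructor
        · rintro ⟨h, h'⟩
          exact ⟨φ.map_adj_iff.1 h, h'⟩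
        · rintro ⟨h, h'⟩
          exact ⟨φ.map_adj_iff.2 h, h'⟩ }
  refine Finset.card_bij (fun a _ => φ a) ?_ ?_ ?_
  · intro a ha
    exact (mem_cluster _ _ _ _).2
      ((ψ.reachable_iff (u := x) (v := a)).2 ((mem_cluster _ _ _ _).1 ha))
  · intro a _ b _ h
    exact φ.injective h
  · intro b hb
    obtain ⟨a, rfl⟩ := φ.surjective b
    refine ⟨a, ?_, rfl⟩
    exact (mem_cluster _ _ _ _).2
      ((ψ.reachable_iff (u := x) (v := a)).1 ((mem_cluster _ _ _ _).1 hb))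

theorem chiLt_trans (G : SimpleGraph V) (htrans : IsTransitive G) (p s : ℝ) (x y : V) :
    chiLt G x p s = chiLt G y p s := by
  obtain ⟨φ, rfl⟩ := htrans x y
  unfold chiLt expect
  let E : Config G ≃ Config G := Equiv.arrowCongr φ.mapEdgeSet (Equiv.refl Bool)
  refine (Fintype.sum_equiv E.symm _ _ fun ω => ?_).symm
  have hE : E.symm ω = pull G φ ω := rfl
  rw [hE]
  beta_reduce
  rw [card_cluster_iso]
  congr 1
  unfold weight
  exact (Fintype.prod_equiv φ.mapEdgeSet _ _ fun e => rfl).symm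

theorem variance_Zgeq (G : SimpleGraph V) (p s : ℝ) :
    variance G p (Zgeq G s) = expect G p (fun ω => Zl G s ω ^ 2) - expect G p (Zl G s) ^ 2 := by
  have h : ∀ ω, Zgeq G s ω = Fintype.card V - Zl G s ω := by
    intro ω
    have : (Fintype.card V : ℝ) = ∑ _x : V, (1 : ℝ) := by simp
    rw [this]
    unfold Zgeq Zl
    rw [← Finset.sum_sub_distrib]
    refine Finset.sum_congr rfl fun x _ => ?_
    unfold q
    by_cases h : s ≤ ((cluster G ω x).card : ℝ)
    · simp [h, not_lt.2 h]
    · simp [h, not_le.1 h]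
  have h' : Zgeq G s = fun ω => (Fintype.card V : ℝ) - Zl G s ω := funext h
  unfold variance
  rw [h', expect_sub, expect_const]
  have : (fun ω => ((Fintype.card V : ℝ) - Zl G s ω) ^ 2) = fun ω =>
      ((Fintype.card V : ℝ) ^ 2 + Zl G s ω * (-2 * Fintype.card V)) + Zl G s ω ^ 2 := by
    funext ω; ring
  rw [this, expect_add, expect_add, expect_const, expect_mul_const]
  ring

theorem magnetization_eq (G : SimpleGraph V) (x : V) (p γ : ℝ) :
    magnetization G x p γ = expect G p (fun ω => 1 - (1 - γ) ^ (cluster G ω x).card) := by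
  unfold magnetization prob expect
  simp only [Finset.mul_sum]
  rw [Finset.sum_comm]
  refine Finset.sum_congr rfl fun ω _ => ?_
  rw [Finset.sum_eq_single (cluster G ω x).card]
  · rw [if_pos rfl, mul_comm]
  · intro b _ hb
    rw [if_neg (Ne.symm hb), mul_zero]
  · intro h
    exfalso
    apply h
    rw [Finset.mem_Icc]
    refine ⟨Finset.card_pos.2 ⟨x, ?_⟩, Finset.card_le_univ _⟩
    rw [mem_cluster]

theorem scalar_bound (s : ℝ) (hs : 1 ≤ s) (k : ℕ) :
    (if (k : ℝ) < s then (k : ℝ) else 0) ≤ (1 - (1 - s⁻¹) ^ k) * (4 * s) := by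
  have hs0 : 0 < s := by linarith
  have hγ0 : 0 < s⁻¹ := inv_pos.2 hs0
  have hγ1 : s⁻¹ ≤ 1 := inv_le_one_of_one_le₀ hs
  have hpow1 : (1 - s⁻¹) ^ k ≤ 1 := pow_le_one₀ (by linarith) (by linarith)
  have hpow0 : 0 ≤ (1 - s⁻¹) ^ k := pow_nonneg (by linarith) _
  split_ifs with h
  · have hb : 1 + (k : ℝ) * s⁻¹ ≤ (1 + s⁻¹) ^ k := one_add_mul_le_pow (by linarith) k
    have hm : (1 + s⁻¹) ^ k * (1 - s⁻¹) ^ k ≤ 1 := by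
      rw [← mul_pow]
      exact pow_le_one₀ (mul_nonneg (by linarith) (by linarith)) (by nlinarith)
    have hc : (1 + (k : ℝ) * s⁻¹) * (1 - s⁻¹) ^ k ≤ 1 :=
      (mul_le_mul_of_nonneg_right hb hpow0).trans hm
    have ht : (k : ℝ) * s⁻¹ ≤ 1 := by
      rw [← div_eq_mul_inv, div_le_one hs0]; exact h.le
    have ht0 : 0 ≤ (k : ℝ) * s⁻¹ := by positivity
    have hk : (k : ℝ) = (k * s⁻¹) * s := by field_simp
    generalize (k : ℝ) * s⁻¹ = t at *
    generalize (1 - s⁻¹) ^ k = u at *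
    rw [hk]
    have : t ≤ (1 - u) * 4 := by nlinarith
    nlinarith
  · exact mul_nonneg (by linarith) (by linarith)

end aux

end Percolation

open Percolation in
/-- Lemma 8.1: supercritical variance bound for `Z_{≥s}` in terms of the
restricted susceptibility and the magnetization. -/
theorem variance_Zgeq_magnetization_bound
    {V : Type*} [Fintype V] [DecidableEq V]
    (G : SimpleGraph V) [DecidableRel G.Adj]
    (hconn : G.Connected) (htrans : IsTransitive G)
    (Ω : ℕ) (hreg : G.IsRegularOfDegree Ω)
    (x₀ : V)
    (s : ℝ) (hs : 1 ≤ s)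
    (p : ℝ) (hp0 : 0 < p) (hp1 : p < 1) :
    variance G p (Zgeq G s) ≤
        (1 + p * (Ω : ℝ) * s) * (Fintype.card V : ℝ) * chiLt G x₀ p s ∧
      (1 + p * (Ω : ℝ) * s) * (Fintype.card V : ℝ) * chiLt G x₀ p s ≤
        4 * s * (1 + p * (Ω : ℝ) * s) * (Fintype.card V : ℝ) *
          magnetization G x₀ p s⁻¹ := by
  constructor
  · rw [variance_Zgeq]
    have h1 : expect G p (fun ω => Zl G s ω ^ 2) =
        ∑ x, expect G p (fun ω => q G s ω x * Zl G s ω) := by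
      rw [← expect_sum]
      congr 1
      funext ω
      rw [← Finset.sum_mul, sq]
      rfl
    have h2 : ∑ x, expect G p (fun ω => q G s ω x) = expect G p (Zl G s) := by
      rw [← expect_sum]
      rfl
    have h3 := Finset.sum_le_sum fun x (_ : x ∈ Finset.univ) =>
      qZ_bound G Ω hreg s hs p hp0 hp1 x
    rw [← h1, Finset.sum_add_distrib, ← Finset.sum_mul, h2] at h3
    rw [Finset.sum_congr rfl fun x _ => by rw [chiLt_trans G htrans p s x x₀],
      Finset.sum_const, nsmul_eq_mul, Finset.card_univ] at h3
    linarith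
  · have h : chiLt G x₀ p s ≤ magnetization G x₀ p s⁻¹ * (4 * s) := by
      rw [magnetization_eq, ← expect_mul_const]
      exact expect_mono G hp0 hp1 fun ω => scalar_bound s hs _
    have hc : 0 ≤ (1 + p * (Ω : ℝ) * s) * (Fintype.card V : ℝ) := by positivity
    have := mul_le_mul_of_nonneg_left h hc
    linarith
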